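/- Let c be a list of length n and 1 ≤ a ≤ b ≤ n, and set K := F(c[a..b]) (so K ≥ 1). Let q be the least index in [a, b] such that F(c[a..q]) ≥ K (such q exists). Then count(c[q], c[a..b]) = K; that is, position q holds an exact mode of the range c[a..b]. -/

import Mathlib

/-- The frequency of a mode of a list: the maximum number of occurrences of any element. -/
def modeFreq {α : Type*} [DecidableEq α] (c : List α) : ℕ :=
  (c.map (fun x => c.count x)).foldr max 0

/-- The contiguous sublist `c[a..b]` of `c` with 1-based inclusive indices. -/
def rangeSlice {α : Type*} (c : List α) (a b : ℕ) : List α :=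
  (c.drop (a - 1)).take (b + 1 - a)

theorem modeFreq_le_iff {α : Type*} [DecidableEq α] (l : List α) (k : ℕ) :
    modeFreq l ≤ k ↔ ∀ x, l.count x ≤ k := by
  have foldr_le (m : List ℕ) : m.foldr max 0 ≤ k ↔ ∀ n ∈ m, n ≤ k := by
    induction m with
    | nil => simp
    | cons n m ih => simp [ih]
  rw [modeFreq, foldr_le, List.forall_mem_map]
  refine ⟨fun h x => ?_, fun h x _ => h x⟩
  by_cases hx : x ∈ l
  · exact h x hx
  · simp [List.count_eq_zero_of_not_mem hx]

theorem count_le_modeFreq {α : Type*} [DecidableEq α] (l : List α) (x : α) :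
    l.count x ≤ modeFreq l :=
  (modeFreq_le_iff l _).1 le_rfl x

theorem rangeSlice_prefix {α : Type*} (c : List α) (a : ℕ) {q b : ℕ} (h : q ≤ b) :
    rangeSlice c a q <+: rangeSlice c a b :=
  List.take_prefix_take_left (by omega)

theorem rangeSlice_eq_append_getD {α : Type*} (c : List α) {a q : ℕ} (d : α)
    (ha : 1 ≤ a) (haq : a ≤ q) (hq : q ≤ c.length) :
    rangeSlice c a q = rangeSlice c a (q - 1) ++ [c.getD (q - 1) d] := by
  have hlen : q - a < (c.drop (a - 1)).length := by
    rw [List.length_drop]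
    omega
  have hidx : a - 1 + (q - a) = q - 1 := by omega
  rw [rangeSlice, rangeSlice, show q + 1 - a = q - a + 1 by omega,
    show q - 1 + 1 - a = q - a by omega, ← List.take_append_getElem hlen,
    List.getD_eq_getElem c d (by omega)]
  simp [hidx]

/-- If `q` is the least index in `[a, b]` such that the mode frequency of `c[a..q]`
reaches `K = F(c[a..b])`, then the element at position `q` is an exact mode of
`c[a..b]`: it occurs exactly `K` times there. -/
theorem stmt2 {α : Type*} [DecidableEq α] [Inhabited α] (c : List α) (a b q : ℕ)
    (ha : 1 ≤ a) (hab : a ≤ b) (hbn : b ≤ c.length)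
    (hq1 : a ≤ q) (hq2 : q ≤ b)
    (hq3 : modeFreq (rangeSlice c a q) ≥ modeFreq (rangeSlice c a b))
    (hq4 : ∀ t, a ≤ t → t < q →
      modeFreq (rangeSlice c a t) < modeFreq (rangeSlice c a b)) :
    (rangeSlice c a b).count (c.getD (q - 1) default) = modeFreq (rangeSlice c a b) := by
  set y := c.getD (q - 1) default
  have hsplit : rangeSlice c a q = rangeSlice c a (q - 1) ++ [y] :=
    rangeSlice_eq_append_getD c default ha hq1 (hq2.trans hbn)
  have hcount (x : α) : (rangeSlice c a q).count x ≤ (rangeSlice c a b).count x :=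
    (rangeSlice_prefix c a hq2).sublist.count_le x
  have hpos : 0 < modeFreq (rangeSlice c a b) := by
    have hy : 0 < (rangeSlice c a q).count y := by simp [hsplit]
    exact hy.trans_le ((hcount y).trans (count_le_modeFreq _ y))
  have hprev : modeFreq (rangeSlice c a (q - 1)) < modeFreq (rangeSlice c a b) := by
    rcases hq1.eq_or_lt with rfl | h
    · have hnil : rangeSlice c a (a - 1) = [] := by simp [rangeSlice, Nat.sub_add_cancel ha]
      simpa [hnil, modeFreq] using hpos
    · exact hq4 _ (by omega) (by omega)
  refine (count_le_modeFreq _ y).antisymm (not_lt.1 fun hlt => ?_)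
  have hle : modeFreq (rangeSlice c a q) ≤ modeFreq (rangeSlice c a b) - 1 := by
    refine (modeFreq_le_iff _ _).2 fun x => ?_
    by_cases hx : x = y
    · subst hx
      exact (hcount _).trans (Nat.le_sub_one_of_lt hlt)
    · have hxy : (rangeSlice c a q).count x = (rangeSlice c a (q - 1)).count x := by
        simp [hsplit, Ne.symm hx]
      rw [hxy]
      exact (count_le_modeFreq _ x).trans (Nat.le_sub_one_of_lt hprev)
  omega
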